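/- arXiv:1911.08129 — 9 statements merged into one kernel-verified Lean document; each statement's English description precedes it below -/
import Mathlib

section
/- Let n ≥ 2 and R ≥ 2, and let (M, (F_m)_{m∈ℕ}) be an R-communication bounded social choice rule for n candidates. Then the rule has distortion at least (2n−4)/ln R − 1: for every real c < (2n−4)/ln R − 1 there exist a number of voters m ≥ 1, a profile Π = (π_v)_{v∈Fin m} of rankings, and a distance function d for m voters consistent with Π, such that Σ_v d(v, F_m(M∘Π)) ≥ c · min_{y candidate} Σ_v d(v, y). -/
open Finset in
open Classical in
/-- Multiplicative weights: if against every nonnegative weighting of `T` some message covers a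
`θ`-fraction of the weight, then some finite sequence of messages covers every element of `T`
almost a `θ`-fraction of the time. -/
theorem exists_sequence_covering {α ρ : Type*} (T : Finset α) (L : ρ → α → Prop) {θ : ℝ}
    (hθ0 : 0 ≤ θ) (hθ1 : θ ≤ 1)
    (h : ∀ u : α → ℝ, (∀ w, 0 ≤ u w) → ∃ r, θ * ∑ w ∈ T, u w ≤ ∑ w ∈ T with L r w, u w)
    {δ : ℝ} (hδ : 0 < δ) :
    ∃ m : ℕ, 1 ≤ m ∧ ∃ r : Fin m → ρ, ∀ w ∈ T,
      (θ - δ) * m ≤ ∑ i, if L (r i) w then (1 : ℝ) else 0 := by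
  obtain ⟨ε, hε0, hε1, hεδ⟩ : ∃ ε : ℝ, 0 < ε ∧ ε ≤ 1 ∧ ε ≤ δ / 2 :=
    ⟨min 1 (δ / 2), by positivity, min_le_left _ _, min_le_right _ _⟩
  have hg : ε - ε ^ 2 ≤ 1 - Real.exp (-ε) := by
    have := (abs_le.1 (Real.abs_exp_sub_one_sub_id_le (x := -ε)
      (by rw [abs_neg, abs_of_pos hε0]; exact hε1))).2
    linarith [neg_sq ε]
  have key : ∀ m : ℕ, ∃ r : Fin m → ρ,
      ∑ w ∈ T, Real.exp (-ε * ∑ i, if L (r i) w then (1 : ℝ) else 0)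
        ≤ #T * Real.exp (-(m * ((ε - ε ^ 2) * θ))) := by
    intro m
    induction m with
    | zero => exact ⟨Fin.elim0, by simp⟩
    | succ m ih =>
      obtain ⟨r, hr⟩ := ih
      set u : α → ℝ := fun w => Real.exp (-ε * ∑ i, if L (r i) w then (1 : ℝ) else 0) with hu
      obtain ⟨s, hs⟩ := h u fun w => (Real.exp_pos _).le
      have hU : 0 ≤ ∑ w ∈ T, u w := sum_nonneg fun w _ => (Real.exp_pos _).le
      refine ⟨Fin.snoc r s, ?_⟩
      have hstep : ∀ w, Real.exp (-ε * ∑ i : Fin (m + 1),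
            if L ((Fin.snoc r s : Fin (m + 1) → ρ) i) w then (1 : ℝ) else 0)
          = u w - (1 - Real.exp (-ε)) * if L s w then u w else 0 := by
        intro w
        simp only [Fin.sum_univ_castSucc, Fin.snoc_castSucc, Fin.snoc_last, mul_add, Real.exp_add,
          hu]
        split_ifs <;> simp
        ring
      rw [sum_congr rfl fun w _ => hstep w, sum_sub_distrib, ← mul_sum, ← sum_filter]
      have hx : 1 - (ε - ε ^ 2) * θ ≤ Real.exp (-((ε - ε ^ 2) * θ)) := by
        linarith [Real.add_one_le_exp (-((ε - ε ^ 2) * θ))]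
      calc ∑ w ∈ T, u w - (1 - Real.exp (-ε)) * ∑ w ∈ T with L s w, u w
          ≤ ∑ w ∈ T, u w - (ε - ε ^ 2) * (θ * ∑ w ∈ T, u w) := by
            have h1 : 0 ≤ ε - ε ^ 2 := by nlinarith
            have := mul_le_mul hg hs (mul_nonneg hθ0 hU) (h1.trans hg)
            linarith
        _ = (1 - (ε - ε ^ 2) * θ) * ∑ w ∈ T, u w := by ring
        _ ≤ Real.exp (-((ε - ε ^ 2) * θ)) * (#T * Real.exp (-(m * ((ε - ε ^ 2) * θ)))) :=
            mul_le_mul hx hr hU (Real.exp_pos _).le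
        _ = #T * Real.exp (-(((m + 1 : ℕ) : ℝ) * ((ε - ε ^ 2) * θ))) := by
            rw [mul_left_comm, ← Real.exp_add]
            push_cast
            ring_nf
  obtain ⟨m, hm⟩ := exists_nat_ge (2 * #T / (ε * δ))
  obtain ⟨r, hr⟩ := key (m + 1)
  refine ⟨m + 1, by omega, r, fun w hw => ?_⟩
  set c : ℝ := ∑ i, if L (r i) w then (1 : ℝ) else 0
  have h1 : Real.exp (-ε * c) ≤ Real.exp (#T - ((m + 1 : ℕ) : ℝ) * ((ε - ε ^ 2) * θ)) := by
    calc Real.exp (-ε * c)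
        ≤ ∑ w ∈ T, Real.exp (-ε * ∑ i, if L (r i) w then (1 : ℝ) else 0) :=
          single_le_sum (f := fun w => Real.exp (-ε * ∑ i, if L (r i) w then (1 : ℝ) else 0))
            (fun _ _ => (Real.exp_pos _).le) hw
      _ ≤ _ := hr
      _ ≤ Real.exp #T * Real.exp (-(((m + 1 : ℕ) : ℝ) * ((ε - ε ^ 2) * θ))) := by
          gcongr
          linarith [Real.add_one_le_exp (#T : ℝ)]
      _ = _ := by rw [← Real.exp_add, ← sub_eq_add_neg]
  rw [Real.exp_le_exp] at h1
  rw [div_le_iff₀ (by positivity)] at hm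
  push_cast at h1 ⊢
  have hm0 : (0 : ℝ) ≤ m := m.cast_nonneg
  refine le_of_mul_le_mul_left ?_ hε0
  have h2 : ε * θ ≤ δ / 2 := by nlinarith
  have h3 : ε * (m + 1) * (ε * θ) ≤ ε * (m + 1) * (δ / 2) := by gcongr
  nlinarith [mul_pos hε0 hδ]

/-- The ranking `π` places every candidate of `S` ahead of every candidate outside `S`. -/
def IsTopSet {n : ℕ} (π : Fin n ≃ Fin n) (S : Finset (Fin n)) : Prop :=
  ∀ x ∈ S, ∀ y ∉ S, π.symm x < π.symm y

/-- The message `r` is compatible with `S` being the set of top candidates. -/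
def Allows {n : ℕ} {ρ : Type*} (M : (Fin n ≃ Fin n) → ρ) (r : ρ) (S : Finset (Fin n)) : Prop :=
  ∃ π, M π = r ∧ IsTopSet π S

open Finset in
open Classical in
/-- If from every set `T` of candidates one can remove a candidate so that at most a `θ`-fraction
of any set of messages stays compatible, then building a ranking from the bottom shows that there
are many messages. -/
theorem one_le_pow_mul_card {n : ℕ} {ρ : Type*} (M : (Fin n ≃ Fin n) → ρ) {θ : ℝ}
    (hθ : 0 ≤ θ)
    (h : ∀ T : Finset (Fin n), T.Nontrivial → ∀ A : Finset ρ,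
      ∃ w ∈ T, (#{r ∈ A | Allows M r (T.erase w)} : ℝ) ≤ θ * #A)
    (k : ℕ) (hk : k < n) (σ : Fin n ≃ Fin n) (A : Finset ρ)
    (hA : ∀ π : Fin n ≃ Fin n, (∀ j : Fin n, k < j → π j = σ j) → M π ∈ A) :
    1 ≤ θ ^ k * #A := by
  induction k generalizing σ A with
  | zero =>
    have : 1 ≤ #A := card_pos.2 ⟨_, hA σ fun _ _ => rfl⟩
    simpa using this
  | succ k ih =>
    set T : Finset (Fin n) := {x | (σ.symm x : ℕ) ≤ k + 1} with hT
    have hTn : T.Nontrivial := by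
      refine ⟨σ ⟨0, by omega⟩, by simp [hT], σ ⟨1, by omega⟩, by simp [hT], ?_⟩
      simp
    obtain ⟨w, hwT, hw⟩ := h T hTn A
    have hwk : (σ.symm w : ℕ) ≤ k + 1 := by simpa [hT] using hwT
    set p : Fin n := ⟨k + 1, hk⟩ with hp
    set σ' : Fin n ≃ Fin n := (Equiv.swap p (σ.symm w)).trans σ with hσ'
    have hσp : σ' p = w := by simp [hσ']
    have hσj : ∀ j : Fin n, k + 1 < (j : ℕ) → σ' j = σ j := by
      intro j hj
      have h1 : j ≠ p := by rintro rfl; simp [hp] at hj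
      have h2 : j ≠ σ.symm w := by rintro rfl; omega
      simp [hσ', Equiv.swap_apply_of_ne_of_ne h1 h2]
    have := ih (by omega) σ' {r ∈ A | Allows M r (T.erase w)} fun π hπ => by
      have hπp : π p = w := by rw [hπ p (by simp [hp]), hσp]
      have hπj : ∀ j : Fin n, k + 1 < (j : ℕ) → π j = σ j := fun j hj => by
        rw [hπ j (by omega), hσj j hj]
      refine mem_filter.2 ⟨hA π hπj, π, rfl, ?_⟩
      have hx : ∀ x, x ∈ T.erase w ↔ (π.symm x : ℕ) ≤ k := by
        intro x
        obtain ⟨j, rfl⟩ := π.surjective x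
        simp only [mem_erase, hT, mem_filter, mem_univ, true_and, Equiv.symm_apply_apply]
        constructor
        · rintro ⟨h1, h2⟩
          by_contra hj
          rcases (show (j : ℕ) = k + 1 ∨ k + 1 < (j : ℕ) by omega) with hj | hj
          · exact h1 (by rw [← hπp]; congr 1; exact Fin.ext hj)
          · rw [hπj j hj] at h2
            simp at h2
            omega
        · intro hj
          refine ⟨fun h1 => ?_, ?_⟩
          · rw [← hπp] at h1
            have := π.injective h1
            rw [this] at hj
            simp [hp] at hj
          · by_contra h2
            push Not at h2
            have := hπj _ h2
            rw [Equiv.apply_symm_apply] at this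
            have := π.injective this
            rw [this] at h2
            omega
      intro x hxS y hyS
      rw [hx] at hxS hyS
      rw [Fin.lt_def]
      omega
    calc (1 : ℝ) ≤ θ ^ k * #{r ∈ A | Allows M r (T.erase w)} := this
      _ ≤ θ ^ k * (θ * #A) := by gcongr
      _ = θ ^ (k + 1) * #A := by ring

open Finset in
open Classical in
/-- With few messages there is a set `T` such that every weighting of `T` is mostly supported on
candidates whose removal from `T` is compatible with some single message. -/
theorem exists_set_forall_weighting {n : ℕ} (hn : 1 ≤ n) {ρ : Type*} [Fintype ρ]
    (M : (Fin n ≃ Fin n) → ρ) {θ : ℝ} (hθ : 0 ≤ θ)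
    (hR : θ ^ (n - 1) * Fintype.card ρ < 1) :
    ∃ T : Finset (Fin n), T.Nontrivial ∧ ∀ u : Fin n → ℝ, (∀ w, 0 ≤ u w) →
      ∃ r, θ * ∑ w ∈ T, u w ≤ ∑ w ∈ T with Allows M r (T.erase w), u w := by
  by_contra! hcon
  refine absurd (one_le_pow_mul_card M hθ (fun T hT A => ?_) (n - 1) (by omega) (Equiv.refl _)
    univ fun _ _ => mem_univ _) (by simpa using hR)
  obtain ⟨u, hu, hur⟩ := hcon T hT
  by_contra! hw
  have hpos : 0 < ∑ w ∈ T, u w := by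
    have h1 := hur (M (Equiv.refl _))
    have h2 : 0 ≤ ∑ w ∈ T with Allows M (M (Equiv.refl _)) (T.erase w), u w :=
      sum_nonneg fun w _ => hu w
    exact pos_of_mul_pos_right (h2.trans_lt h1) hθ
  obtain ⟨w₀, hw₀, hw₀pos⟩ := (sum_pos_iff_of_nonneg fun w _ => hu w).1 hpos
  have h1 : ∑ w ∈ T, u w * (θ * #A) < ∑ w ∈ T, u w * #{r ∈ A | Allows M r (T.erase w)} :=
    sum_lt_sum (fun w h => mul_le_mul_of_nonneg_left (hw w h).le (hu w))
      ⟨w₀, hw₀, mul_lt_mul_of_pos_left (hw w₀ hw₀) hw₀pos⟩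
  have h2 : ∑ w ∈ T, u w * #{r ∈ A | Allows M r (T.erase w)}
      = ∑ r ∈ A, ∑ w ∈ T with Allows M r (T.erase w), u w := by
    simp only [sum_filter, card_filter, Nat.cast_sum, mul_sum]
    rw [sum_comm]
    simp
  have h3 : ∑ r ∈ A, ∑ w ∈ T with Allows M r (T.erase w), u w ≤ ∑ _r ∈ A, θ * ∑ w ∈ T, u w :=
    sum_le_sum fun r _ => (hur r).le
  rw [← sum_mul] at h1
  rw [sum_const, nsmul_eq_mul] at h3
  linarith [mul_left_comm (∑ w ∈ T, u w) θ (#A : ℝ), mul_left_comm (#A : ℝ) θ (∑ w ∈ T, u w),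
    mul_comm (∑ w ∈ T, u w) (#A : ℝ)]

open Finset in
open Classical in
/-- Two-point metric: if `w ∉ S` and most rankings of the profile have `S` on top, then `w` is
expensive compared with the candidates in `S`. -/
theorem exists_distance_of_isTopSet {n m : ℕ} (hm : 1 ≤ m) (P : Fin m → (Fin n ≃ Fin n))
    (S : Finset (Fin n)) (hS : S.Nonempty) (w : Fin n) (hw : w ∉ S) (c : ℝ)
    (hc : (c + 1) * (m - ∑ v, if IsTopSet (P v) S then (1 : ℝ) else 0) ≤ 2 * m)
    (hne : (univ : Finset (Fin n)).Nonempty) :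
    ∃ d : Fin m → Fin n → ℝ,
      (∀ v x, 0 ≤ d v x) ∧
      (∀ v v' x y, d v y ≤ d v x + d v' x + d v' y) ∧
      (∀ (v : Fin m) (i j : Fin n), i ≤ j → d v (P v i) ≤ d v (P v j)) ∧
      0 < ∑ v, d v w ∧ c * univ.inf' hne (fun y => ∑ v, d v y) ≤ ∑ v, d v w := by
  set d : Fin m → Fin n → ℝ := fun v x =>
    if IsTopSet (P v) S then (if x ∈ S then 0 else 2) else 1 with hd
  have hd0 : ∀ v x, 0 ≤ d v x := fun v x => by
    simp only [hd]; split_ifs <;> norm_num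
  have hm' : (1 : ℝ) ≤ m := by exact_mod_cast hm
  set g : ℝ := ∑ v, if IsTopSet (P v) S then (1 : ℝ) else 0 with hg
  have hg0 : 0 ≤ g := sum_nonneg fun v _ => by split_ifs <;> norm_num
  have hcw : ∑ v, d v w = m + g := by
    have : ∀ v, d v w = 1 + if IsTopSet (P v) S then (1 : ℝ) else 0 := fun v => by
      simp only [hd, if_neg hw]; split_ifs <;> norm_num
    simp only [this, sum_add_distrib, hg]
    simp
  obtain ⟨y, hy⟩ := hS
  have hcy : ∑ v, d v y = m - g := by
    have : ∀ v, d v y = 1 - if IsTopSet (P v) S then (1 : ℝ) else 0 := fun v => by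
      simp only [hd, hy]; split_ifs <;> norm_num
    simp only [this, sum_sub_distrib, hg]
    simp
  refine ⟨d, hd0, ?_, ?_, by rw [hcw]; linarith, ?_⟩
  · intro v v' x y
    simp only [hd]
    split_ifs <;> norm_num
  · intro v i j hij
    simp only [hd]
    split_ifs with h hi hj hj
    · exact le_rfl
    · norm_num
    · have := h _ hj _ hi
      simp only [Equiv.symm_apply_apply] at this
      exact absurd this (not_lt.2 hij)
    · exact le_rfl
    · exact le_rfl
  · have hle : univ.inf' hne (fun y => ∑ v, d v y) ≤ m - g :=
      hcy ▸ inf'_le (fun y => ∑ v, d v y) (mem_univ y)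
    have hge : 0 ≤ univ.inf' hne (fun y => ∑ v, d v y) :=
      le_inf' _ _ fun y _ => sum_nonneg fun v _ => hd0 v y
    rw [hcw]
    rcases le_total 0 c with h0 | h0
    · nlinarith
    · nlinarith

open Finset in
open Classical in
/-- A nondegenerate and slightly stronger form of the lower bound: the elected candidate has
positive cost, so the distance function cannot be identically zero. -/
theorem exists_profile_of_surjective (n : ℕ) {ρ : Type*} [Fintype ρ] (R : ℕ) (hn : 2 ≤ n)
    (hR : 2 ≤ R) (hρ : Fintype.card ρ ≤ R) (M : (Fin n ≃ Fin n) → ρ) (hM : M.Surjective)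
    (F : ∀ m : ℕ, (Fin m → ρ) → Fin n)
    (c : ℝ) (hc : c < 2 * ((n : ℝ) - 1) / Real.log R - 1)
    (hne : (univ : Finset (Fin n)).Nonempty) :
    ∃ (m : ℕ), 1 ≤ m ∧ ∃ (P : Fin m → (Fin n ≃ Fin n)) (d : Fin m → Fin n → ℝ),
      (∀ v x, 0 ≤ d v x) ∧
      (∀ v v' x y, d v y ≤ d v x + d v' x + d v' y) ∧
      (∀ (v : Fin m) (i j : Fin n), i ≤ j → d v (P v i) ≤ d v (P v j)) ∧
      0 < ∑ v, d v (F m (fun v => M (P v))) ∧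
      c * univ.inf' hne (fun y => ∑ v, d v y) ≤ ∑ v, d v (F m (fun v => M (P v))) := by
  have hR' : (2 : ℝ) ≤ R := by exact_mod_cast hR
  have hn' : (2 : ℝ) ≤ n := by exact_mod_cast hn
  have hlog : 0 < Real.log R := Real.log_pos (by linarith)
  have hn1 : (0 : ℝ) < n - 1 := by linarith
  obtain ⟨q, hq, hcq⟩ : ∃ q : ℝ, Real.log R / (n - 1) < q ∧ (c + 1) * q ≤ 2 := by
    rcases le_or_gt (c + 1) 0 with h | h
    · refine ⟨Real.log R / (n - 1) + 1, by linarith, ?_⟩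
      have : 0 < Real.log R / (n - 1) := by positivity
      nlinarith
    · refine ⟨2 / (c + 1), ?_, by field_simp; exact le_rfl⟩
      have h1 : (c + 1) < 2 * ((n : ℝ) - 1) / Real.log R := by linarith
      rw [lt_div_iff₀ hlog] at h1
      rw [div_lt_div_iff₀ hn1 h]
      linarith
  obtain ⟨p, hp, hpq⟩ := exists_between hq
  have hp0 : 0 < p := lt_trans (by positivity) hp
  have hcard : Real.exp (-p) ^ (n - 1) * Fintype.card ρ < 1 := by
    rw [← Real.exp_nat_mul, Nat.cast_sub (by omega), Nat.cast_one]
    calc Real.exp ((n - 1) * -p) * (Fintype.card ρ : ℝ)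
        ≤ Real.exp ((n - 1) * -p) * R := by gcongr
      _ = Real.exp ((n - 1) * -p + Real.log R) := by
          rw [Real.exp_add, Real.exp_log (by linarith)]
      _ < 1 := by
          rw [Real.exp_lt_one_iff]
          rw [div_lt_iff₀ hn1] at hp
          linarith
  obtain ⟨T, hT, hu⟩ := exists_set_forall_weighting (by omega) M (Real.exp_pos _).le hcard
  obtain ⟨m, hm, r, hr⟩ := exists_sequence_covering T (fun r w => Allows M r (T.erase w))
    (Real.exp_pos _).le (Real.exp_le_one_iff.2 (by linarith)) hu (sub_pos.2 hpq)
  obtain ⟨z, hz, hzw⟩ : ∃ z ∈ T, F m r ∉ T.erase z := by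
    by_cases hF : F m r ∈ T
    · exact ⟨_, hF, notMem_erase _ _⟩
    · obtain ⟨z, hz⟩ := hT.nonempty
      exact ⟨z, hz, fun h => hF (mem_of_mem_erase h)⟩
  have hP : ∀ v, ∃ π, M π = r v ∧ (Allows M (r v) (T.erase z) → IsTopSet π (T.erase z)) := by
    intro v
    by_cases h : Allows M (r v) (T.erase z)
    · obtain ⟨π, h1, h2⟩ := h
      exact ⟨π, h1, fun _ => h2⟩
    · obtain ⟨π, h1⟩ := hM (r v)
      exact ⟨π, h1, fun h' => absurd h' h⟩
  choose P hPM hPS using hP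
  have hMP : (fun v => M (P v)) = r := funext hPM
  refine ⟨m, hm, P, ?_⟩
  rw [hMP]
  refine exists_distance_of_isTopSet hm P (T.erase z) (hT.erase_nonempty) _ hzw c ?_ hne
  have hcov := hr z hz
  have hle : ∑ v, (if Allows M (r v) (T.erase z) then (1 : ℝ) else 0)
      ≤ ∑ v, if IsTopSet (P v) (T.erase z) then (1 : ℝ) else 0 :=
    sum_le_sum fun v _ => by
      by_cases h : Allows M (r v) (T.erase z)
      · simp [h, hPS v h]
      · rw [if_neg h]; split_ifs <;> norm_num
  have hm' : (0 : ℝ) < m := by exact_mod_cast hm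
  have hexp : 1 - p ≤ Real.exp (-p) := by linarith [Real.add_one_le_exp (-p)]
  set g : ℝ := ∑ v, if IsTopSet (P v) (T.erase z) then (1 : ℝ) else 0
  have hgm : g ≤ m := by
    calc g ≤ ∑ _v : Fin m, (1 : ℝ) := sum_le_sum fun v _ => by split_ifs <;> norm_num
      _ = m := by simp
  have hbad : m - g ≤ q * m := by nlinarith
  rcases le_total (c + 1) 0 with h | h
  · nlinarith
  · nlinarith [mul_le_mul_of_nonneg_left hbad h]


/-- Every one-round `R`-communication bounded social choice rule
(each voter sends one of `R` possible messages, determined by her ranking)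
for `n ≥ 2` candidates has distortion at least `(2n - 4)/ln R - 1`. -/
theorem communication_bounded_lower_bound (n R : ℕ) (hn : 2 ≤ n) (hR : 2 ≤ R)
    (M : (Fin n ≃ Fin n) → Fin R)
    (F : ∀ m : ℕ, (Fin m → Fin R) → Fin n)
    (c : ℝ) (hc : c < (2 * (n : ℝ) - 4) / Real.log R - 1) :
    ∃ (m : ℕ), 1 ≤ m ∧ ∃ (P : Fin m → (Fin n ≃ Fin n)) (d : Fin m → Fin n → ℝ),
      (∀ v x, 0 ≤ d v x) ∧
      (∀ v v' x y, d v y ≤ d v x + d v' x + d v' y) ∧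
      (∀ (v : Fin m) (i j : Fin n), i ≤ j → d v (P v i) ≤ d v (P v j)) ∧
      c * (Finset.univ.inf' ⟨(⟨0, by omega⟩ : Fin n), Finset.mem_univ _⟩
            (fun y : Fin n => ∑ v, d v y)) ≤ ∑ v, d v (F m (fun v => M (P v))) := by
  classical
  have hlog : 0 < Real.log R := Real.log_pos (by exact_mod_cast hR)
  have hc' : c < 2 * ((n : ℝ) - 1) / Real.log R - 1 := by
    refine hc.trans_le ?_
    gcongr
    linarith
  have hcard : Fintype.card (Set.range M) ≤ R := by
    simpa only [Fintype.card_fin] using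
      Fintype.card_le_of_injective (Subtype.val : Set.range M → Fin R) Subtype.val_injective
  obtain ⟨m, hm, P, d, h0, htri, hcons, -, hcost⟩ :=
    exists_profile_of_surjective n R hn hR hcard (Set.rangeFactorization M)
      Set.rangeFactorization_surjective (fun m s => F m fun v => s v) c hc'
      ⟨⟨0, by omega⟩, Finset.mem_univ _⟩
  exact ⟨m, hm, P, d, h0, htri, hcons, hcost⟩
end

section
/- Let X be a pseudometric space, V a finite nonempty index set of voters with location map loc : V → X, and C ⊆ X a finite set of n candidates, with 1 ≤ k ≤ n. Suppose each voter v has an ordered top-k list, an injective map L_v : {1,…,k} → C, that is consistent with the metric: dist(loc v, L_v(i)) ≤ dist(loc v, L_v(j)) whenever i ≤ j, and dist(loc v, L_v(k)) ≤ dist(loc v, y) for every candidate y not in the image of L_v. With α = k/(3n), define the comparison graph G, the set S_2, and a winner W as below. Then for every candidate x ∈ C, cost(W) ≤ (79·n/k) · cost(x). -/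
open Finset in
/-- In a relation that is irreflexive and total on distinct elements of `S`, an element of maximal
out-degree reaches every element of `S` in at most two steps. -/
theorem exists_short_path_of_max_outdegree {X : Type*} (S : Finset X) (G : X → X → Prop)
    (W : X) (hW : W ∈ S) (hirr : ¬ G W W)
    (htot : ∀ x ∈ S, ∀ y ∈ S, x ≠ y → G x y ∨ G y x)
    (hmax : ∀ x ∈ S, Nat.card {y : X // y ∈ S ∧ G x y} ≤ Nat.card {y : X // y ∈ S ∧ G W y})
    (y : X) (hy : y ∈ S) : W = y ∨ G W y ∨ ∃ z ∈ S, G W z ∧ G z y := by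
  classical
  by_contra! h
  obtain ⟨hne, hWy, hz⟩ := h
  have hcard : ∀ x, Nat.card {y : X // y ∈ S ∧ G x y} = (S.filter (G x)).card := fun x ↦
    Nat.subtype_card _ (by simp)
  have hsub : S.filter (G W) ⊂ S.filter (G y) := by
    refine (ssubset_iff_of_subset fun z hzW ↦ ?_).2 ⟨W, ?_, by simp [hirr]⟩
    · obtain ⟨hzS, hWz⟩ := mem_filter.1 hzW
      have hzy : z ≠ y := by rintro rfl; exact hWy hWz
      exact mem_filter.2 ⟨hzS, (htot z hzS y hy hzy).resolve_left (hz z hzS hWz)⟩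
    · exact mem_filter.2 ⟨hW, (htot W hW y hy hne).resolve_left hWy⟩
  have := hmax y hy
  rw [hcard, hcard] at this
  exact absurd (card_lt_card hsub) this.not_gt

/-- If at least `m` voters are at least as close to `a` as to `b`, then the distance from `a` to
`x` exceeds that from `b` to `x` by at most `2 / m` times the cost of `x`. -/
theorem mul_dist_le_of_card_le {X V : Type*} [PseudoMetricSpace X] [Fintype V] (loc : V → X)
    (A : Finset V) (a b x : X) (hA : ∀ v ∈ A, dist (loc v) a ≤ dist (loc v) b)
    (m : ℝ) (hm : 0 ≤ m) (hmA : m ≤ A.card) :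
    m * dist a x ≤ 2 * ∑ v, dist (loc v) x + m * dist b x := by
  have hcost : 0 ≤ ∑ v, dist (loc v) x := Finset.sum_nonneg fun _ _ ↦ dist_nonneg
  rcases le_total (dist a x) (dist b x) with h | h
  · nlinarith [mul_le_mul_of_nonneg_left h hm]
  · have h1 : (A.card : ℝ) * (dist a x - dist b x) ≤ ∑ v ∈ A, 2 * dist (loc v) x := by
      rw [← nsmul_eq_mul]
      refine Finset.card_nsmul_le_sum _ _ _ fun v hv ↦ ?_
      linarith [hA v hv, dist_triangle_left a x (loc v), dist_triangle_right (loc v) b x]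
    have h2 : ∑ v ∈ A, dist (loc v) x ≤ ∑ v, dist (loc v) x :=
      Finset.sum_le_univ_sum_of_nonneg fun _ ↦ dist_nonneg
    rw [← Finset.mul_sum] at h1
    nlinarith [mul_le_mul_of_nonneg_right hmA (sub_nonneg.2 h)]

/-- Markov's inequality for the distances of the voters to `x`. -/
theorem card_filter_sum_dist_lt_le {X V : Type*} [PseudoMetricSpace X] [Fintype V] (loc : V → X)
    (x : X) (m : ℝ) (hm : 0 ≤ m) [DecidablePred fun w ↦ ∑ v, dist (loc v) x < m * dist (loc w) x] :
    ((Finset.univ.filter fun w ↦ ∑ v, dist (loc v) x < m * dist (loc w) x).card : ℝ) ≤ m := by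
  set F := Finset.univ.filter fun w ↦ ∑ v, dist (loc v) x < m * dist (loc w) x with hF
  rcases F.eq_empty_or_nonempty with h | h
  · simpa [h] using hm
  · have h1 : ∑ _w ∈ F, ∑ v, dist (loc v) x < ∑ w ∈ F, m * dist (loc w) x :=
      Finset.sum_lt_sum_of_nonempty h fun w hw ↦ (Finset.mem_filter.1 hw).2
    have h2 : ∑ v ∈ F, dist (loc v) x ≤ ∑ v, dist (loc v) x :=
      Finset.sum_le_univ_sum_of_nonneg fun _ ↦ dist_nonneg
    rw [Finset.sum_const, nsmul_eq_mul, ← Finset.mul_sum] at h1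
    exact (lt_of_mul_lt_mul_right (h1.trans_le (mul_le_mul_of_nonneg_left h2 hm))
      (Finset.sum_nonneg fun _ _ ↦ dist_nonneg)).le

open Finset in
/-- The top-`k` lists contain `k` entries per voter in total. -/
theorem sum_card_filter_listed {X V : Type*} [Fintype V] [DecidableEq X] (C : Finset X) (k : ℕ)
    (L : V → Fin k → X) (hLmem : ∀ v i, L v i ∈ C) (hLinj : ∀ v, Function.Injective (L v)) :
    ∑ y ∈ C, (univ.filter fun v ↦ ∃ i, L v i = y).card = Fintype.card V * k := by
  have h := sum_card_bipartiteAbove_eq_sum_card_bipartiteBelow (s := C) (t := (univ : Finset V))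
    (fun y v ↦ ∃ i, L v i = y)
  simp only [bipartiteAbove, bipartiteBelow] at h
  rw [h, sum_congr rfl (g := fun _ ↦ k)]
  · simp
  · intro v _
    have : (C.filter fun y ↦ ∃ i, L v i = y) = univ.image (L v) := by
      ext y
      simp only [mem_filter, mem_image, mem_univ, true_and, and_iff_right_iff_imp]
      rintro ⟨i, rfl⟩
      exact hLmem v i
    rw [this, card_image_of_injective _ (hLinj v), card_univ, Fintype.card_fin]

open Finset in
/-- If `x` is on the lists of fewer than `2 * m` voters, where `3 * m * |C| = k * |V|`, then some
voter who is close to `x` and does not list `x` lists a candidate that is on at least `2 * m`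
lists. -/
theorem exists_near_voter_listing {X V : Type*} [PseudoMetricSpace X] [Fintype V] [DecidableEq X]
    (loc : V → X) (C : Finset X) (k : ℕ) (L : V → Fin k → X) (hLmem : ∀ v i, L v i ∈ C)
    (hLinj : ∀ v, Function.Injective (L v)) (m : ℝ) (hm : 0 ≤ m)
    (hmk : 3 * m * C.card = Fintype.card V * k) (x : X) (hx : x ∈ C)
    (hxm : ((univ.filter fun v ↦ ∃ i, L v i = x).card : ℝ) < 2 * m) :
    ∃ y ∈ C, 2 * m ≤ ((univ.filter fun v ↦ ∃ i, L v i = y).card : ℝ) ∧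
      ∃ w, m * dist (loc w) x ≤ ∑ v, dist (loc v) x ∧ (∃ i, L w i = y) ∧ ∀ i, L w i ≠ x := by
  classical
  by_contra! h
  have hlt : ∀ y ∈ C, ((univ.filter fun v ↦ ∃ i, L v i = y).card : ℝ) < 3 * m := by
    intro y hy
    rcases lt_or_ge ((univ.filter fun v ↦ ∃ i, L v i = y).card : ℝ) (2 * m) with hlt | hge
    · linarith
    · have hsub : (univ.filter fun v ↦ ∃ i, L v i = y) ⊆ (univ.filter fun v ↦ ∃ i, L v i = x) ∪
          univ.filter fun w ↦ ∑ v, dist (loc v) x < m * dist (loc w) x := by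
        intro w hw
        simp only [mem_filter, mem_union, mem_univ, true_and] at hw ⊢
        by_contra! hc
        obtain ⟨j, hj⟩ := h y hy hge w hc.2 hw
        exact hc.1 j hj
      have hcard : ((univ.filter fun v ↦ ∃ i, L v i = y).card : ℝ) ≤
          (univ.filter fun v ↦ ∃ i, L v i = x).card +
          (univ.filter fun w ↦ ∑ v, dist (loc v) x < m * dist (loc w) x).card := by
        exact_mod_cast (card_le_card hsub).trans (card_union_le _ _)
      linarith [card_filter_sum_dist_lt_le loc x m hm]
  have hsum := sum_lt_sum_of_nonempty ⟨x, hx⟩ hlt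
  have htotal : ∑ y ∈ C, ((univ.filter fun v ↦ ∃ i, L v i = y).card : ℝ) =
      Fintype.card V * k := by
    exact_mod_cast sum_card_filter_listed C k L hLmem hLinj
  rw [htotal, sum_const, nsmul_eq_mul] at hsum
  linarith

/-- Theorem: the mechanism has distortion at most `79n/k`:
voters and candidates live in a pseudometric space; each voter reports her
(metrically consistent) top-`k` list; the winner `W`, a maximum-outdegree
candidate of the induced comparison graph on `S₂`, has cost at most
`(79 n / k)` times the cost of any candidate. -/
theorem topk_copeland_distortion {X : Type*} [PseudoMetricSpace X]
    {V : Type*} [Fintype V] [Nonempty V] (loc : V → X)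
    (C : Finset X) (n k : ℕ) (hC : C.card = n) (hk1 : 1 ≤ k) (hkn : k ≤ n)
    (L : V → Fin k → X)
    (hLmem : ∀ v i, L v i ∈ C)
    (hLinj : ∀ v, Function.Injective (L v))
    (hLsort : ∀ (v : V) (i j : Fin k), i ≤ j →
      dist (loc v) (L v i) ≤ dist (loc v) (L v j))
    (hLtop : ∀ (v : V), ∀ y ∈ C, (∀ i, L v i ≠ y) →
      dist (loc v) (L v ⟨k - 1, by omega⟩) ≤ dist (loc v) y)
    (α : ℝ) (hα : α = (k : ℝ) / (3 * n))
    (prefers : V → X → X → Prop)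
    (hprefers : ∀ v x y, prefers v x y ↔
      ((∃ i j : Fin k, i < j ∧ L v i = x ∧ L v j = y) ∨
       ((∃ i, L v i = x) ∧ ∀ j, L v j ≠ y)))
    (G : X → X → Prop)
    (hG : ∀ x y, G x y ↔
      α * (Fintype.card V : ℝ) ≤ (Nat.card {v : V // prefers v x y} : ℝ))
    (S₂ : Finset X)
    (hS₂ : ∀ x, x ∈ S₂ ↔ x ∈ C ∧
      2 * α * (Fintype.card V : ℝ) ≤ (Nat.card {v : V // ∃ i, L v i = x} : ℝ))
    (W : X) (hW : W ∈ S₂)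
    (hWmax : ∀ x ∈ S₂,
      Nat.card {y : X // y ∈ S₂ ∧ G x y} ≤ Nat.card {y : X // y ∈ S₂ ∧ G W y}) :
    ∀ x ∈ C, ∑ v, dist (loc v) W ≤ (79 * (n : ℝ) / k) * ∑ v, dist (loc v) x := by
  classical
  intro x hx
  have hkR : (1 : ℝ) ≤ k := by exact_mod_cast hk1
  have hknR : (k : ℝ) ≤ n := by exact_mod_cast hkn
  have hnR : (0 : ℝ) < n := by linarith
  have hN : (0 : ℝ) < Fintype.card V := by exact_mod_cast Fintype.card_pos
  have hαpos : 0 < α := by rw [hα]; positivity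
  have hm : 0 < α * Fintype.card V := mul_pos hαpos hN
  have hmk : 3 * (α * Fintype.card V) * C.card = Fintype.card V * k := by
    rw [hC, hα]; field_simp
  have hcardV : ∀ (P : V → Prop) [DecidablePred P],
      Nat.card {v // P v} = (Finset.univ.filter P).card := fun P _ ↦
    Nat.subtype_card _ (by simp)
  have hlisted : ∀ v i, ∀ b ∈ C, (∀ j, L v j ≠ b) → dist (loc v) (L v i) ≤ dist (loc v) b :=
    fun v i b hb hnot ↦ (hLsort v i _ (Fin.le_def.2 (by have := i.2; simp only; omega))).trans
      (hLtop v b hb hnot)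
  have hclose : ∀ v a, ∀ b ∈ C, prefers v a b → dist (loc v) a ≤ dist (loc v) b := by
    intro v a b hb hp
    rcases (hprefers v a b).1 hp with ⟨i, j, hij, rfl, rfl⟩ | ⟨⟨i, rfl⟩, hnot⟩
    · exact hLsort v i j hij.le
    · exact hlisted v i b hb hnot
  have hstep : ∀ a, ∀ b ∈ C, G a b → α * Fintype.card V * dist a x ≤
      2 * ∑ v, dist (loc v) x + α * Fintype.card V * dist b x := by
    intro a b hb hab
    rw [hG, hcardV] at hab
    exact mul_dist_le_of_card_le loc _ a b x
      (fun v hv ↦ hclose v a b hb (Finset.mem_filter.1 hv).2) _ hm.le hab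
  have hirr : ¬ G W W := by
    rw [hG, hcardV, Finset.filter_false_of_mem]
    · simpa using hm
    · rintro v - hp
      rcases (hprefers v W W).1 hp with ⟨i, j, hij, hi, hj⟩ | ⟨⟨i, hi⟩, hnot⟩
      · exact hij.ne (hLinj v (hi.trans hj.symm))
      · exact hnot i hi
  have htot : ∀ a ∈ S₂, ∀ b ∈ S₂, a ≠ b → G a b ∨ G b a := by
    intro a ha b _ hne
    have h2 := ((hS₂ a).1 ha).2
    rw [hG, hG, hcardV, hcardV]
    rw [hcardV] at h2
    have hsub : (Finset.univ.filter fun v ↦ ∃ i, L v i = a) ⊆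
        Finset.univ.filter (fun v ↦ prefers v a b) ∪
          Finset.univ.filter (fun v ↦ prefers v b a) := by
      intro v hv
      obtain ⟨i, hi⟩ := (Finset.mem_filter.1 hv).2
      simp only [Finset.mem_union, Finset.mem_filter, Finset.mem_univ, true_and, hprefers]
      by_cases hb : ∃ j, L v j = b
      · obtain ⟨j, hj⟩ := hb
        rcases lt_trichotomy i j with hij | rfl | hij
        · exact Or.inl (Or.inl ⟨i, j, hij, hi, hj⟩)
        · exact absurd (hi.symm.trans hj) hne
        · exact Or.inr (Or.inl ⟨j, i, hij, hj, hi⟩)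
      · exact Or.inl (Or.inr ⟨⟨i, hi⟩, not_exists.1 hb⟩)
    have hle : ((Finset.univ.filter fun v ↦ ∃ i, L v i = a).card : ℝ) ≤
        (Finset.univ.filter fun v ↦ prefers v a b).card +
          (Finset.univ.filter fun v ↦ prefers v b a).card := by
      exact_mod_cast (Finset.card_le_card hsub).trans (Finset.card_union_le _ _)
    by_contra! hc
    linarith [hc.1, hc.2]
  have hcost : 0 ≤ ∑ v, dist (loc v) x := Finset.sum_nonneg fun _ _ ↦ dist_nonneg
  obtain ⟨y, hyS, hyx⟩ : ∃ y ∈ S₂, α * Fintype.card V * dist y x ≤ 2 * ∑ v, dist (loc v) x := by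
    by_cases hxS : x ∈ S₂
    · exact ⟨x, hxS, by simpa using hcost⟩
    · have hxm : ((Finset.univ.filter fun v ↦ ∃ i, L v i = x).card : ℝ) <
          2 * (α * Fintype.card V) := by
        by_contra! hc
        exact hxS ((hS₂ x).2 ⟨hx, by rw [hcardV]; linarith⟩)
      obtain ⟨y, hyC, hy2, w, hw, ⟨i, hi⟩, hnot⟩ :=
        exists_near_voter_listing loc C k L hLmem hLinj _ hm.le hmk x hx hxm
      refine ⟨y, (hS₂ y).2 ⟨hyC, by rw [hcardV]; linarith⟩, ?_⟩
      have hwy : dist (loc w) y ≤ dist (loc w) x := hi ▸ hlisted w i x hx hnot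
      have hdist : dist y x ≤ 2 * dist (loc w) x := by
        linarith [dist_triangle_left y x (loc w)]
      nlinarith [mul_le_mul_of_nonneg_left hdist hm.le]
  have hWx : α * Fintype.card V * dist W x ≤ 6 * ∑ v, dist (loc v) x := by
    have hyC := ((hS₂ y).1 hyS).1
    rcases exists_short_path_of_max_outdegree S₂ G W hW hirr htot hWmax y hyS with
      rfl | h | ⟨z, hz, hWz, hzy⟩
    · linarith
    · linarith [hstep W y hyC h]
    · linarith [hstep W z ((hS₂ z).1 hz).1 hWz, hstep z y hyC hzy]
  have hsum : ∑ v, dist (loc v) W ≤ ∑ v, dist (loc v) x + Fintype.card V * dist W x := by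
    calc ∑ v, dist (loc v) W ≤ ∑ v, (dist (loc v) x + dist W x) :=
          Finset.sum_le_sum fun v _ ↦ dist_triangle_right _ _ _
      _ = _ := by simp [Finset.sum_add_distrib]
  have hNd : (Fintype.card V : ℝ) * dist W x ≤ 18 * (n / k) * ∑ v, dist (loc v) x := by
    have hkey : (Fintype.card V : ℝ) * dist W x =
        3 * (n / k) * (α * Fintype.card V * dist W x) := by
      rw [hα]; field_simp
    rw [hkey]
    have hnk : (0 : ℝ) ≤ 3 * (n / k) := by positivity
    linarith [mul_le_mul_of_nonneg_left hWx hnk]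
  have hone : (1 : ℝ) ≤ n / k := by rw [le_div_iff₀ (by linarith)]; linarith
  rw [mul_div_assoc]
  nlinarith [mul_le_mul_of_nonneg_right hone hcost]
end

section
/- Let V be a finite nonempty set of voters, C a finite set of n candidates, and 1 ≤ k ≤ n. Suppose each voter v has an ordered top-k list, an injective map L_v : {1,…,k} → C. With α = k/(3n), define the comparison graph G, the set S_2, and a winner W as below. Then S_2 is nonempty, and for every candidate x ∈ C there is a directed path in G of at most 3 edges from W to x. -/
open Finset in
/-- Double counting of the pairs (voter in `P`, candidate on her list). -/
theorem sum_card_filter_list {V C : Type*} [Fintype C] {k : ℕ} (L : V → Fin k → C)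
    (hL : ∀ v, Function.Injective (L v)) (P : Finset V) [∀ y, DecidablePred fun v => ∃ i, L v i = y] :
    ∑ y : C, #{v ∈ P | ∃ i, L v i = y} = k * #P := by
  classical
  have h := sum_card_bipartiteAbove_eq_sum_card_bipartiteBelow
    (s := (univ : Finset C)) (t := P) (fun y v => ∃ i, L v i = y)
  have hrow : ∀ v ∈ P, #(bipartiteBelow (fun y v => ∃ i, L v i = y) univ v) = k := by
    intro v _
    have himage : bipartiteBelow (fun y v => ∃ i, L v i = y) univ v = univ.image (L v) := by
      ext y
      simp [bipartiteBelow]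
    rw [himage, card_image_of_injective _ (hL v), card_univ, Fintype.card_fin]
  rw [sum_congr rfl hrow, sum_const, smul_eq_mul, mul_comm] at h
  rw [← h]
  refine sum_congr rfl fun y _ => ?_
  congr 1

open Finset in
/-- A sum bounded by `a` on `S` and by `b` off `S`. -/
theorem sum_le_of_le_on_of_le_off {C : Type*} [Fintype C] (S : Finset C) (f : C → ℝ) {a b : ℝ}
    (ha : ∀ y ∈ S, f y ≤ a) (hb : ∀ y ∉ S, f y ≤ b) :
    ∑ y, f y ≤ #S * a + (Fintype.card C - #S) * b := by
  classical
  rw [← sum_add_sum_compl S f]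
  have h1 := sum_le_card_nsmul S f a ha
  have h2 := sum_le_card_nsmul Sᶜ f b fun y hy => hb y (mem_compl.1 hy)
  rw [nsmul_eq_mul] at h1 h2
  rw [card_compl, Nat.cast_sub (card_le_univ S)] at h2
  exact add_le_add h1 h2

/-- In a semicomplete digraph, given by an irreflexive relation on `S`, a vertex of maximum
out-degree reaches every other vertex in at most two steps. -/
theorem exists_path_le_two_of_max_outDegree {C : Type*} [Finite C] {G : C → C → Prop}
    {S : Finset C} {W : C} (hW : W ∈ S) (hirr : ∀ x, ¬ G x x)
    (htot : ∀ x ∈ S, ∀ y ∈ S, x ≠ y → G x y ∨ G y x)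
    (hmax : ∀ x ∈ S, Nat.card {y : C // y ∈ S ∧ G x y} ≤ Nat.card {y : C // y ∈ S ∧ G W y})
    {y : C} (hy : y ∈ S) : y = W ∨ G W y ∨ ∃ a, G W a ∧ G a y := by
  by_contra! h
  obtain ⟨hne, hWy, hpath⟩ := h
  have hlt : {z | z ∈ S ∧ G W z} ⊂ {z | z ∈ S ∧ G y z} := by
    rw [Set.ssubset_iff_of_subset]
    · exact ⟨W, ⟨hW, (htot y hy W hW hne).resolve_right hWy⟩, fun hz => hirr W hz.2⟩
    · rintro z ⟨hz, hWz⟩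
      have hzy : y ≠ z := fun e => hWy (e ▸ hWz)
      exact ⟨hz, (htot y hy z hz hzy).resolve_right (hpath z hWz)⟩
  exact (hmax y hy).not_gt (Set.ncard_lt_ncard hlt (Set.toFinite _))

/-- The numerical core: `κ = k / n`, `σ` is the proportion of candidates listed often, and `t` is
the proportion of voters who do not list a given candidate. -/
theorem false_of_listing_bounds {κ σ t : ℝ} (hκ : 0 < κ) (hκ1 : κ ≤ 1)
    (hmass : κ ≤ σ + (1 - σ) * (2 * κ / 3)) (ht : 1 - 2 * κ / 3 < t)
    (h1 : κ * t ≤ σ * (κ / 3) + (1 - σ) * (2 * κ / 3))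
    (h2 : κ * t ≤ σ * (κ / 3) + (1 - σ) * t) : False := by
  have ht' : t ≤ (2 - σ) / 3 := le_of_mul_le_mul_left (by linarith) hκ
  have hσ : σ < 2 * κ - 1 := by linarith
  have hσκ : κ ≤ σ * (3 - 2 * κ) := by nlinarith
  have hquad : (4 * κ - 3) * (1 - κ) > 0 := by nlinarith
  have hκlt : κ < 1 := lt_of_le_of_ne hκ1 (by rintro rfl; norm_num at hquad)
  have hκgt : 3 / 4 < κ := by nlinarith
  have hsum : 0 ≤ κ + σ - 1 := by
    by_contra! hneg
    nlinarith
  have hprod : (1 - 2 * κ / 3) * (κ + σ - 1) ≤ t * (κ + σ - 1) :=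
    mul_le_mul_of_nonneg_right ht.le hsum
  have hσle : 3 * σ ≤ 3 - 2 * κ := by
    refine le_of_mul_le_mul_left ?_ (sub_pos.2 hκlt)
    linarith
  nlinarith

open Finset in
/-- A candidate listed by fewer than a `2α` fraction of the voters loses to some candidate listed
by at least a `2α` fraction, on an `α` fraction of the ballots omitting it. -/
theorem exists_mem_le_card_lists_not_lists {V C : Type*} [Fintype V] [Nonempty V] [Fintype C]
    {k : ℕ} (hk1 : 1 ≤ k) (hkn : k ≤ Fintype.card C) (L : V → Fin k → C)
    (hL : ∀ v, Function.Injective (L v)) {α : ℝ} (hα : α = k / (3 * Fintype.card C))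
    {S : Finset C}
    (hS : ∀ x, x ∈ S ↔
      2 * α * (Fintype.card V : ℝ) ≤ (Nat.card {v : V // ∃ i, L v i = x} : ℝ))
    {x : C} (hx : x ∉ S) :
    ∃ b ∈ S, α * (Fintype.card V : ℝ) ≤
      (Nat.card {v : V // (∃ i, L v i = b) ∧ ∀ j, L v j ≠ x} : ℝ) := by
  classical
  by_contra! hcon
  have hcard (p : V → Prop) [DecidablePred p] : Nat.card {v // p v} = #{v | p v} := by
    rw [Nat.card_eq_fintype_card, Fintype.card_subtype]
  simp only [hcard] at hS hcon
  have hN : (0 : ℝ) < Fintype.card V := by exact_mod_cast Fintype.card_pos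
  have hk : (0 : ℝ) < k := by exact_mod_cast hk1
  have hkn' : (k : ℝ) ≤ Fintype.card C := by exact_mod_cast hkn
  have hn : (0 : ℝ) < Fintype.card C := hk.trans_le hkn'
  have hoff : ∀ y ∉ S, (#{v | ∃ i, L v i = y} : ℝ) < 2 * α * Fintype.card V := fun y hy =>
    not_le.1 fun h => hy ((hS y).2 h)
  set U : Finset V := {v | ∀ j, L v j ≠ x}
  have hcompl : (#{v | ∃ i, L v i = x} : ℝ) + #U = Fintype.card V := by
    have h := card_filter_add_card_filter_not (s := (univ : Finset V)) (fun v => ∃ i, L v i = x)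
    simp only [not_exists] at h
    exact_mod_cast h
  have hsumV : ∑ y, (#{v | ∃ i, L v i = y} : ℝ) = k * Fintype.card V := by
    exact_mod_cast sum_card_filter_list L hL univ
  have hsumU : ∑ y, (#{v ∈ U | ∃ i, L v i = y} : ℝ) = k * #U := by
    exact_mod_cast sum_card_filter_list L hL U
  have hUS : ∀ y ∈ S, (#{v ∈ U | ∃ i, L v i = y} : ℝ) ≤ α * Fintype.card V := by
    intro y hy
    refine le_trans (le_of_eq ?_) (hcon y hy).le
    rw [filter_filter]
    simp only [and_comm]
  have hUle : ∀ y, (#{v ∈ U | ∃ i, L v i = y} : ℝ) ≤ #{v | ∃ i, L v i = y} := fun y => by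
    exact_mod_cast card_le_card (filter_subset_filter _ (subset_univ U))
  have hmass := sum_le_of_le_on_of_le_off S (fun y => (#{v | ∃ i, L v i = y} : ℝ))
    (a := Fintype.card V) (fun y _ => by exact_mod_cast card_le_univ _) fun y hy => (hoff y hy).le
  have h1 := sum_le_of_le_on_of_le_off S _ hUS fun y hy => (hUle y).trans (hoff y hy).le
  have h2 := sum_le_of_le_on_of_le_off S _ hUS (b := #U) fun y _ => by
    exact_mod_cast card_filter_le _ _
  rw [hsumV] at hmass
  rw [hsumU] at h1 h2
  have hx' := hoff x hx
  generalize (Fintype.card V : ℝ) = N at *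
  generalize (Fintype.card C : ℝ) = n at *
  generalize (#S : ℝ) = s at *
  generalize (#U : ℝ) = u at *
  have hκ : α = k / n / 3 := by rw [hα]; field_simp
  have hscale {a b : ℝ} (h : n * N * a ≤ n * N * b) : a ≤ b :=
    le_of_mul_le_mul_left h (mul_pos hn hN)
  subst hκ
  refine false_of_listing_bounds (κ := k / n) (σ := s / n) (t := u / N) (div_pos hk hn)
    ((div_le_one hn).2 hkn') (hscale ?_) ?_ (hscale ?_) (hscale ?_)
  · calc _ = k * N := by field_simp
      _ ≤ _ := hmass
      _ = _ := by field_simp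
  · rw [lt_div_iff₀ hN]
    linarith
  · calc _ = k * u := by field_simp
      _ ≤ _ := h1
      _ = _ := by field_simp
  · calc _ = k * u := by field_simp
      _ ≤ _ := h2
      _ = _ := by field_simp


/-- key structural lemma: with `α = k/(3n)`, the set `S₂` of
candidates appearing on at least a `2α` fraction of top-`k` lists is nonempty,
and the maximum-outdegree candidate `W` of the comparison graph induced on
`S₂` has a directed path of at most 3 edges in `G` to every candidate. -/
theorem topk_winner_short_paths {V : Type*} [Fintype V] [Nonempty V]
    {C : Type*} [Fintype C] (n k : ℕ) (hC : Fintype.card C = n)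
    (hk1 : 1 ≤ k) (hkn : k ≤ n)
    (L : V → Fin k → C)
    (hLinj : ∀ v, Function.Injective (L v))
    (α : ℝ) (hα : α = (k : ℝ) / (3 * n))
    (prefers : V → C → C → Prop)
    (hprefers : ∀ v x y, prefers v x y ↔
      ((∃ i j : Fin k, i < j ∧ L v i = x ∧ L v j = y) ∨
       ((∃ i, L v i = x) ∧ ∀ j, L v j ≠ y)))
    (G : C → C → Prop)
    (hG : ∀ x y, G x y ↔
      α * (Fintype.card V : ℝ) ≤ (Nat.card {v : V // prefers v x y} : ℝ))
    (S₂ : Finset C)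
    (hS₂ : ∀ x, x ∈ S₂ ↔
      2 * α * (Fintype.card V : ℝ) ≤ (Nat.card {v : V // ∃ i, L v i = x} : ℝ))
    (W : C) (hW : W ∈ S₂)
    (hWmax : ∀ x ∈ S₂,
      Nat.card {y : C // y ∈ S₂ ∧ G x y} ≤ Nat.card {y : C // y ∈ S₂ ∧ G W y}) :
    S₂.Nonempty ∧
      ∀ x : C, x = W ∨ G W x ∨ (∃ a, G W a ∧ G a x) ∨
        (∃ a b, G W a ∧ G a b ∧ G b x) := by
  subst hC
  have hN : (0 : ℝ) < Fintype.card V := by exact_mod_cast Fintype.card_pos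
  have hαN : 0 < α * Fintype.card V := by
    have hk : (0 : ℝ) < k := by exact_mod_cast hk1
    have hn : (0 : ℝ) < Fintype.card C := by exact_mod_cast hk1.trans hkn
    rw [hα]
    positivity
  have hirr : ∀ x, ¬ G x x := by
    intro x hx
    have hempty : IsEmpty {v // prefers v x x} := by
      refine ⟨fun ⟨v, hv⟩ => ?_⟩
      rcases (hprefers v x x).1 hv with ⟨i, j, hij, hi, hj⟩ | ⟨⟨i, hi⟩, h⟩
      · exact hij.ne (hLinj v (hi.trans hj.symm))
      · exact h i hi
    rw [hG, Nat.card_of_isEmpty] at hx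
    exact hx.not_gt (by simpa using hαN)
  have htot : ∀ x ∈ S₂, ∀ y ∈ S₂, x ≠ y → G x y ∨ G y x := by
    intro x hx y _ hxy
    have hsub : {v | ∃ i, L v i = x} ⊆ {v | prefers v x y} ∪ {v | prefers v y x} := by
      rintro v ⟨i, hi⟩
      simp only [Set.mem_union, Set.mem_ofPred_eq, hprefers]
      by_cases hy : ∃ j, L v j = y
      · obtain ⟨j, hj⟩ := hy
        rcases lt_trichotomy i j with h | rfl | h
        · exact Or.inl (Or.inl ⟨i, j, h, hi, hj⟩)
        · exact absurd (hi.symm.trans hj) hxy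
        · exact Or.inr (Or.inl ⟨j, i, h, hj, hi⟩)
      · exact Or.inl (Or.inr ⟨⟨i, hi⟩, fun j hj => hy ⟨j, hj⟩⟩)
    have hle : Nat.card {v // ∃ i, L v i = x} ≤
        Nat.card {v // prefers v x y} + Nat.card {v // prefers v y x} :=
      (Set.ncard_le_ncard hsub (Set.toFinite _)).trans (Set.ncard_union_le _ _)
    have hle' : (Nat.card {v // ∃ i, L v i = x} : ℝ) ≤
        Nat.card {v // prefers v x y} + Nat.card {v // prefers v y x} := by exact_mod_cast hle
    have hx' := (hS₂ x).1 hx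
    rw [hG, hG]
    by_contra! h
    linarith [h.1, h.2]
  refine ⟨⟨W, hW⟩, fun x => ?_⟩
  by_cases hx : x ∈ S₂
  · rcases exists_path_le_two_of_max_outDegree hW hirr htot hWmax hx with h | h | h
    · exact Or.inl h
    · exact Or.inr (Or.inl h)
    · exact Or.inr (Or.inr (Or.inl h))
  · obtain ⟨b, hb, hbx⟩ := exists_mem_le_card_lists_not_lists hk1 hkn L hLinj hα hS₂ hx
    have hGbx : G b x := by
      refine (hG b x).2 (hbx.trans ?_)
      exact_mod_cast Set.ncard_le_ncard (fun v hv => (hprefers v b x).2 (Or.inr hv))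
        (Set.toFinite {v | prefers v b x})
    rcases exists_path_le_two_of_max_outDegree hW hirr htot hWmax hb with rfl | h | ⟨a, hWa, hab⟩
    · exact Or.inr (Or.inl hGbx)
    · exact Or.inr (Or.inr (Or.inl ⟨b, h, hGbx⟩))
    · exact Or.inr (Or.inr (Or.inr ⟨a, b, hWa, hab, hGbx⟩))
end

section
/- Let X be a pseudometric space, V a finite nonempty index set of voters with location map loc : V → X, α > 0, ℓ ≥ 1, and let y_0, y_1, …, y_ℓ ∈ X be points (candidates). Suppose that for each i with 0 ≤ i < ℓ, at least α·|V| voters v satisfy dist(loc v, y_i) ≤ dist(loc v, y_{i+1}). Then cost(y_0) ≤ (1 + (3^ℓ − 1)/α) · cost(y_ℓ). -/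
/-- If at least `α * |V|` voters are at least as close to `x` as to `x'`, then moving from `x'` to
`x` increases the distance to any point `z` by at most `2 / (α * |V|)` times the cost of `z`. -/
theorem mul_card_mul_dist_sub_dist_le {X : Type*} [PseudoMetricSpace X]
    {V : Type*} [Fintype V] (loc : V → X) {α : ℝ} (hα : 0 ≤ α) (x x' z : X)
    (h : α * (Fintype.card V : ℝ) ≤
      (Nat.card {v : V // dist (loc v) x ≤ dist (loc v) x'} : ℝ)) :
    α * (Fintype.card V : ℝ) * (dist x z - dist x' z) ≤ 2 * ∑ v, dist (loc v) z := by
  classical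
  have hC : 0 ≤ ∑ v, dist (loc v) z := Finset.sum_nonneg fun v _ => dist_nonneg
  set S : Finset V := {v | dist (loc v) x ≤ dist (loc v) x'}
  have hcard : Nat.card {v : V // dist (loc v) x ≤ dist (loc v) x'} = S.card := by
    rw [Nat.card_eq_fintype_card, Fintype.card_subtype]
  rw [hcard] at h
  have hsum : (S.card : ℝ) * (dist x z - dist x' z) ≤ 2 * ∑ v, dist (loc v) z := calc
    (S.card : ℝ) * (dist x z - dist x' z) = ∑ _v ∈ S, (dist x z - dist x' z) := by
      rw [Finset.sum_const, nsmul_eq_mul]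
    _ ≤ ∑ v ∈ S, 2 * dist (loc v) z := by
      refine Finset.sum_le_sum fun v hv => ?_
      have hv' : dist (loc v) x ≤ dist (loc v) x' := (Finset.mem_filter.mp hv).2
      have h₁ := dist_triangle_left x z (loc v)
      have h₂ := dist_triangle_right (loc v) x' z
      linarith
    _ ≤ ∑ v, 2 * dist (loc v) z :=
      Finset.sum_le_univ_sum_of_nonneg fun v => by positivity
    _ = 2 * ∑ v, dist (loc v) z := by rw [Finset.mul_sum]
  rcases le_total 0 (dist x z - dist x' z) with hd | hd
  · exact (mul_le_mul_of_nonneg_right h hd).trans hsum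
  · exact (mul_nonpos_of_nonneg_of_nonpos (by positivity) hd).trans (by positivity)

/-- cost-ratio along a path: if for each consecutive pair
`y_i, y_{i+1}` along a sequence `y_0, …, y_ℓ` at least an `α` fraction of the
voters is at least as close to `y_i` as to `y_{i+1}`, then
`cost(y_0) ≤ (1 + (3^ℓ - 1)/α) · cost(y_ℓ)`. -/
theorem path_cost_ratio {X : Type*} [PseudoMetricSpace X]
    {V : Type*} [Fintype V] [Nonempty V] (loc : V → X)
    (α : ℝ) (hα : 0 < α) (ℓ : ℕ) (hℓ : 1 ≤ ℓ)
    (y : Fin (ℓ + 1) → X)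
    (hpath : ∀ i : Fin ℓ, α * (Fintype.card V : ℝ) ≤
      (Nat.card {v : V // dist (loc v) (y i.castSucc) ≤ dist (loc v) (y i.succ)} : ℝ)) :
    ∑ v, dist (loc v) (y 0) ≤
      (1 + ((3 : ℝ) ^ ℓ - 1) / α) * ∑ v, dist (loc v) (y (Fin.last ℓ)) := by
  have hC : 0 ≤ ∑ v, dist (loc v) (y (Fin.last ℓ)) := Finset.sum_nonneg fun v _ => dist_nonneg
  have hdist : ∀ i : Fin (ℓ + 1),
      α * (Fintype.card V : ℝ) * dist (y i) (y (Fin.last ℓ)) ≤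
        2 * ((ℓ : ℝ) - (i : ℕ)) * ∑ v, dist (loc v) (y (Fin.last ℓ)) := by
    intro i
    induction i using Fin.reverseInduction with
    | last => simp
    | cast i ih =>
      have hstep := mul_card_mul_dist_sub_dist_le loc hα.le _ _ (y (Fin.last ℓ)) (hpath i)
      simp only [Fin.val_succ, Fin.val_castSucc, Nat.cast_add, Nat.cast_one] at ih ⊢
      linarith
  have hpow : 2 * (ℓ : ℝ) ≤ 3 ^ ℓ - 1 := by
    have := one_add_mul_le_pow (a := (2 : ℝ)) (by norm_num) ℓ
    norm_num at this
    linarith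
  have hmove : (Fintype.card V : ℝ) * dist (y 0) (y (Fin.last ℓ)) ≤
      ((3 : ℝ) ^ ℓ - 1) / α * ∑ v, dist (loc v) (y (Fin.last ℓ)) := by
    rw [div_mul_eq_mul_div, le_div_iff₀ hα]
    have h₀ := hdist 0
    simp only [Fin.val_zero, Nat.cast_zero, sub_zero] at h₀
    linarith [mul_le_mul_of_nonneg_right hpow hC]
  calc
    ∑ v, dist (loc v) (y 0)
        ≤ ∑ v, (dist (loc v) (y (Fin.last ℓ)) + dist (y 0) (y (Fin.last ℓ))) :=
      Finset.sum_le_sum fun v _ => dist_triangle_right _ _ _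
    _ = ∑ v, dist (loc v) (y (Fin.last ℓ)) +
          (Fintype.card V : ℝ) * dist (y 0) (y (Fin.last ℓ)) := by
      rw [Finset.sum_add_distrib, Finset.sum_const, nsmul_eq_mul, Finset.card_univ]
    _ ≤ _ := by linarith
end

section
/- Let X be a pseudometric space, V a finite nonempty index set of voters with location map loc : V → X, α > 0, ℓ ≥ 1, and let y_0, y_1, …, y_ℓ ∈ X be points (candidates). Suppose that for each i with 0 ≤ i < ℓ, at least α·|V| voters v satisfy dist(loc v, y_i) ≤ dist(loc v, y_{i+1}). Then at least α·|V| voters v satisfy dist(loc v, y_ℓ) ≥ dist(y_0, y_ℓ)/(3^ℓ − 1). -/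
/-- If each term of a finite sequence is less than the next one plus `c`, the first term is less
than the last one plus `n * c`. -/
lemma Fin.zero_lt_last_add_mul {n : ℕ} (hn : 1 ≤ n) (f : Fin (n + 1) → ℝ) (c : ℝ)
    (h : ∀ i : Fin n, f i.castSucc < f i.succ + c) :
    f 0 < f (Fin.last n) + n * c := by
  have key : ∀ i : Fin (n + 1), i = 0 ∨ f 0 < f i + (i : ℕ) * c := by
    intro i
    induction i using Fin.induction with
    | zero => exact Or.inl rfl
    | succ i ih =>
      right
      have hi := h i
      rcases ih with h0 | hlt
      · have hval : (i : ℕ) = 0 := by simpa using congrArg Fin.val h0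
        rw [h0] at hi
        simpa [hval] using hi
      · simp only [Fin.val_castSucc, Fin.val_succ] at hlt ⊢
        push_cast
        linarith
  rcases key (Fin.last n) with h0 | hlt
  · have := congrArg Fin.val h0
    simp at this
    omega
  · simpa using hlt


/-- if for each consecutive pair `y_i, y_{i+1}` along a sequence
`y_0, …, y_ℓ` at least an `α` fraction of the voters is at least as close to
`y_i` as to `y_{i+1}`, then at least an `α` fraction of the voters is at
distance at least `dist(y_0, y_ℓ)/(3^ℓ - 1)` from `y_ℓ`. -/
theorem path_far_voters {X : Type*} [PseudoMetricSpace X]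
    {V : Type*} [Fintype V] [Nonempty V] (loc : V → X)
    (α : ℝ) (hα : 0 < α) (ℓ : ℕ) (hℓ : 1 ≤ ℓ)
    (y : Fin (ℓ + 1) → X)
    (hpath : ∀ i : Fin ℓ, α * (Fintype.card V : ℝ) ≤
      (Nat.card {v : V // dist (loc v) (y i.castSucc) ≤ dist (loc v) (y i.succ)} : ℝ)) :
    α * (Fintype.card V : ℝ) ≤
      (Nat.card {v : V //
        dist (y 0) (y (Fin.last ℓ)) / ((3 : ℝ) ^ ℓ - 1) ≤
          dist (loc v) (y (Fin.last ℓ))} : ℝ) := by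
  by_contra! hcon
  set r := dist (y 0) (y (Fin.last ℓ)) / ((3 : ℝ) ^ ℓ - 1) with hr
  have hbern : (2 : ℝ) * ℓ ≤ 3 ^ ℓ - 1 := by
    have := one_add_mul_le_pow (show (-2 : ℝ) ≤ 2 by norm_num) ℓ
    norm_num at this
    linarith
  have hℓ' : (1 : ℝ) ≤ ℓ := by exact_mod_cast hℓ
  have hden : (0 : ℝ) < 3 ^ ℓ - 1 := by linarith
  have hr0 : 0 ≤ r := by positivity
  have hstep : ∀ i : Fin ℓ, dist (y i.castSucc) (y (Fin.last ℓ)) <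
      dist (y i.succ) (y (Fin.last ℓ)) + 2 * r := by
    intro i
    obtain ⟨v, hv, hnear⟩ : ∃ v, dist (loc v) (y i.castSucc) ≤ dist (loc v) (y i.succ) ∧
        dist (loc v) (y (Fin.last ℓ)) < r := by
      by_contra! hfar
      have hcard : Nat.card {v : V // dist (loc v) (y i.castSucc) ≤ dist (loc v) (y i.succ)} ≤
          Nat.card {v : V // r ≤ dist (loc v) (y (Fin.last ℓ))} :=
        Nat.card_le_card_of_injective _ (Subtype.impEmbedding _ _ hfar).injective
      exact absurd (hpath i) (not_le.mpr ((Nat.cast_le.mpr hcard).trans_lt hcon))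
    have h₁ := dist_triangle_left (y i.castSucc) (y (Fin.last ℓ)) (loc v)
    have h₂ := dist_triangle_right (loc v) (y i.succ) (y (Fin.last ℓ))
    linarith
  have hlt := Fin.zero_lt_last_add_mul hℓ (fun i => dist (y i) (y (Fin.last ℓ))) _ hstep
  have hdist : r * (3 ^ ℓ - 1) = dist (y 0) (y (Fin.last ℓ)) := div_mul_cancel₀ _ hden.ne'
  simp only [dist_self, zero_add] at hlt
  nlinarith [mul_le_mul_of_nonneg_left hbern hr0]
end

section
/- Let X be a pseudometric space, V a finite nonempty index set of voters with location map loc : V → X, and C ⊆ X a finite set of n ≥ 2 candidates. Let top : V → C satisfy dist(loc v, top v) ≤ dist(loc v, x) for every voter v and candidate x ∈ C, and for x ∈ C let ν_x = |{v : top v = x}|/|V|. For each candidate x define p_x = ((n−2)/(n−1))·ν_x + (1/(n−1))·ν_x² / (Σ_{y∈C} ν_y²). Then for every candidate z ∈ C, Σ_{x∈C} p_x · cost(x) ≤ (3 − 2/n) · cost(z). -/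
/-- For a candidate with share `t` among `m + 1` candidates, where `S` is the sum of the squared
shares, the probability of electing it times `1 - t` is at most `m / (m + 1) * t`. -/
theorem mixed_weight_le {m t S : ℝ} (hm : 1 ≤ m) (ht0 : 0 ≤ t) (hS0 : 0 < S)
    (hS : (1 - t) ^ 2 ≤ m * (S - t ^ 2)) :
    ((m - 1) / m * t + 1 / m * t ^ 2 / S) * (1 - t) ≤ m / (m + 1) * t := by
  have hm0 : 0 < m := by linarith
  have cubic : 0 ≤ (1 + (m ^ 2 - 1) * t) * (m * t ^ 2 + (1 - t) ^ 2)
      - (m + 1) * m * t * (1 - t) := by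
    have h : 0 ≤ ((m + 1) * t - 1) ^ 2 * ((m - 1) * t + 1) :=
      mul_nonneg (sq_nonneg _) (by nlinarith)
    linarith
  have hcoef : 0 ≤ 1 + (m ^ 2 - 1) * t := by
    have : 0 ≤ (m ^ 2 - 1) * t := mul_nonneg (by nlinarith) ht0
    linarith
  have hscaled : (m + 1) * m * t * (1 - t) ≤ (1 + (m ^ 2 - 1) * t) * (m * S) := by
    have := mul_le_mul_of_nonneg_left
      (show m * t ^ 2 + (1 - t) ^ 2 ≤ m * S by linarith) hcoef
    linarith
  have hdiff : m / (m + 1) * t - ((m - 1) / m * t + 1 / m * t ^ 2 / S) * (1 - t)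
      = t * ((1 + (m ^ 2 - 1) * t) * (m * S) - (m + 1) * m * t * (1 - t))
        / (m ^ 2 * (m + 1) * S) := by
    field_simp
    ring
  have : 0 ≤ t * ((1 + (m ^ 2 - 1) * t) * (m * S) - (m + 1) * m * t * (1 - t))
        / (m ^ 2 * (m + 1) * S) :=
    div_nonneg (mul_nonneg ht0 (by linarith)) (by positivity)
  linarith

/-- The square of the total of the entries other than `x` is at most their number times the sum
of their squares. -/
theorem sq_sub_le_card_sub_one_mul {X : Type*} {C : Finset X} {x : X} (hx : x ∈ C) (f : X → ℝ) :
    (∑ y ∈ C, f y - f x) ^ 2 ≤ ((C.card : ℝ) - 1) * (∑ y ∈ C, f y ^ 2 - f x ^ 2) := by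
  classical
  have h := sq_sum_le_card_mul_sum_sq (s := C.erase x) (f := f)
  rwa [Finset.cast_card_erase_of_mem hx, Finset.sum_erase_eq_sub hx,
    Finset.sum_erase_eq_sub hx] at h


/-- the mixture of Random Dictatorship (weight `(n-2)/(n-1)`)
and Proportional to Squares (weight `1/(n-1)`), using only each voter's first
choice, has expected cost at most `(3 - 2/n)` times the cost of any candidate. -/
theorem mixed_mechanism_distortion {X : Type*} [PseudoMetricSpace X]
    {V : Type*} [Fintype V] [Nonempty V] (loc : V → X)
    (C : Finset X) (n : ℕ) (hC : C.card = n) (hn : 2 ≤ n)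
    (top : V → X) (htopmem : ∀ v, top v ∈ C)
    (htop : ∀ (v : V), ∀ x ∈ C, dist (loc v) (top v) ≤ dist (loc v) x)
    (ν : X → ℝ)
    (hν : ∀ x, ν x = (Nat.card {v : V // top v = x} : ℝ) / (Fintype.card V : ℝ))
    (p : X → ℝ)
    (hp : ∀ x, p x = ((n : ℝ) - 2) / ((n : ℝ) - 1) * ν x
      + (1 / ((n : ℝ) - 1)) * (ν x) ^ 2 / (∑ y ∈ C, (ν y) ^ 2)) :
    ∀ z ∈ C, ∑ x ∈ C, p x * (∑ v, dist (loc v) x) ≤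
      (3 - 2 / (n : ℝ)) * ∑ v, dist (loc v) z := by
  classical
  intro z hz
  set N : ℝ := (Fintype.card V : ℝ)
  set S : ℝ := ∑ y ∈ C, ν y ^ 2 with hSdef
  have hN : 0 < N := Nat.cast_pos.mpr Fintype.card_pos
  have hcard (x : X) : N * ν x = ((Finset.univ.filter fun v => top v = x).card : ℝ) := by
    rw [hν, mul_div_cancel₀ _ hN.ne', Nat.card_eq_fintype_card, Fintype.card_subtype]
  have hfiber (g : X → ℝ) : ∑ x ∈ C, N * ν x * g x = ∑ v, g (top v) := by
    rw [← Finset.sum_fiberwise_of_maps_to (fun v _ => htopmem v) fun v => g (top v)]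
    refine Finset.sum_congr rfl fun x _ => ?_
    rw [Finset.sum_congr rfl fun v hv => congrArg g (Finset.mem_filter.mp hv).2,
      Finset.sum_const, nsmul_eq_mul, hcard]
  have hν0 (x : X) : 0 ≤ ν x := by rw [hν]; positivity
  have hνsum : ∑ x ∈ C, ν x = 1 := by
    have h := hfiber fun _ => 1
    simp only [mul_one, ← Finset.mul_sum, Finset.sum_const, nsmul_eq_mul, Finset.card_univ] at h
    exact mul_left_cancel₀ hN.ne' (h.trans (mul_one N).symm)
  have hS : 0 < S := by
    have h := sq_sum_le_card_mul_sum_sq (s := C) (f := ν)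
    rw [hνsum, ← hSdef] at h
    by_contra! hS
    nlinarith [mul_nonpos_of_nonneg_of_nonpos (Nat.cast_nonneg (α := ℝ) C.card) hS]
  have hn' : (2 : ℝ) ≤ n := by exact_mod_cast hn
  have hn1 : (n : ℝ) - 1 ≠ 0 := by linarith
  have hp0 (x : X) : 0 ≤ p x := by
    have h1 : (0 : ℝ) ≤ n - 1 := by linarith
    have h2 : (0 : ℝ) ≤ n - 2 := by linarith
    have h3 := hν0 x
    rw [hp]
    positivity
  have hpsum : ∑ x ∈ C, p x = 1 := by
    simp_rw [hp]
    rw [Finset.sum_add_distrib, ← Finset.mul_sum, ← Finset.sum_div, ← Finset.mul_sum, hνsum,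
      ← hSdef]
    field_simp
    ring
  have hweight (x : X) (hx : x ∈ C) : p x * (1 - ν x) ≤ (1 - 1 / n) * ν x := by
    have hsq := sq_sub_le_card_sub_one_mul hx ν
    rw [hνsum, ← hSdef, hC] at hsq
    have h := mixed_weight_le (m := n - 1) (by linarith) (hν0 x) hS hsq
    have hcoef : ((n : ℝ) - 1) / (n - 1 + 1) = 1 - 1 / n := by
      rw [sub_add_cancel, sub_div, div_self (by linarith)]
    rw [hp]
    rwa [hcoef, show (n : ℝ) - 1 - 1 = n - 2 by ring] at h
  have hcost (x : X) :
      ∑ v, dist (loc v) x ≤ ∑ v, dist (loc v) z + N * (1 - ν x) * dist x z := by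
    have hv (v : V) :
        dist (loc v) x ≤ dist (loc v) z + (dist x z - if top v = x then dist x z else 0) := by
      split_ifs with h
      · have := htop v z hz
        rw [h] at this
        linarith
      · have := dist_triangle_right (loc v) x z
        linarith
    refine (Finset.sum_le_sum fun v _ => hv v).trans_eq ?_
    rw [Finset.sum_add_distrib, Finset.sum_sub_distrib, ← Finset.sum_filter, Finset.sum_const,
      Finset.sum_const, nsmul_eq_mul, nsmul_eq_mul, ← hcard, Finset.card_univ]
    ring
  have hlower : ∑ x ∈ C, N * ν x * dist x z ≤ 2 * ∑ v, dist (loc v) z := by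
    rw [hfiber fun x => dist x z, Finset.mul_sum]
    refine Finset.sum_le_sum fun v _ => ?_
    have := dist_triangle_left (top v) z (loc v)
    linarith [htop v z hz]
  calc ∑ x ∈ C, p x * ∑ v, dist (loc v) x
      ≤ ∑ x ∈ C, (p x * ∑ v, dist (loc v) z + (1 - 1 / n) * (N * ν x * dist x z)) := by
        refine Finset.sum_le_sum fun x hx => ?_
        have h1 := mul_le_mul_of_nonneg_left (hcost x) (hp0 x)
        have h2 := mul_le_mul_of_nonneg_left (hweight x hx)
          (mul_nonneg hN.le (dist_nonneg (x := x) (y := z)))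
        linarith
    _ = ∑ v, dist (loc v) z + (1 - 1 / n) * ∑ x ∈ C, N * ν x * dist x z := by
        rw [Finset.sum_add_distrib, ← Finset.sum_mul, hpsum, one_mul, Finset.mul_sum]
    _ ≤ ∑ v, dist (loc v) z + (1 - 1 / n) * (2 * ∑ v, dist (loc v) z) := by
        have : (1 : ℝ) / n ≤ 1 := by rw [div_le_one (by linarith)]; linarith
        gcongr
    _ = (3 - 2 / (n : ℝ)) * ∑ v, dist (loc v) z := by ring
end

section
/- Let X be a pseudometric space, V a finite nonempty index set of voters with location map loc : V → X, and C ⊆ X a finite set of candidates. Let top : V → C satisfy dist(loc v, top v) ≤ dist(loc v, x) for every voter v and candidate x ∈ C, and for x ∈ C let ν_x = |{v : top v = x}|/|V|. Let p : C → ℝ satisfy p_x ≥ 0 for all x, Σ_{x∈C} p_x = 1, and p_x = 0 whenever ν_x = 0, and let B ∈ ℝ satisfy p_x·(1−ν_x)/ν_x ≤ B for every x with ν_x > 0. Then for every candidate z ∈ C, Σ_{x∈C} p_x · cost(x) ≤ (1 + 2B) · cost(z). -/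
open Classical in
/-- Voters whose first choice is `x` do not lose by moving from `z` to `x`; every other voter
loses at most `dist x z`. -/
theorem sum_dist_le_sum_dist_add_card_mul {X V : Type*} [PseudoMetricSpace X] [Fintype V]
    (loc : V → X) (top : V → X) (x z : X)
    (htop : ∀ v, dist (loc v) (top v) ≤ dist (loc v) z) :
    ∑ v, dist (loc v) x ≤ ∑ v, dist (loc v) z +
      ((Fintype.card V : ℝ) - (Finset.univ.filter fun v => top v = x).card) * dist x z := by
  have key : ∀ v, dist (loc v) x ≤
      dist (loc v) z + (dist x z - if top v = x then dist x z else 0) := by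
    intro v
    split_ifs with h
    · simpa [h] using htop v
    · linarith [dist_triangle_right (loc v) x z]
  refine (Finset.sum_le_sum fun v _ => key v).trans_eq ?_
  rw [Finset.sum_add_distrib, Finset.sum_sub_distrib, ← Finset.sum_filter]
  simp [sub_mul]

open Classical in
/-- A voter whose first choice is `x` is at distance at least `dist x z / 2` from `z`. -/
theorem card_mul_dist_le_two_mul_sum {X V : Type*} [PseudoMetricSpace X] [Fintype V]
    (loc : V → X) (top : V → X) (x z : X)
    (htop : ∀ v, dist (loc v) (top v) ≤ dist (loc v) z) :
    ((Finset.univ.filter fun v => top v = x).card : ℝ) * dist x z ≤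
      2 * ∑ v with top v = x, dist (loc v) z := by
  rw [← nsmul_eq_mul, Finset.mul_sum]
  refine Finset.card_nsmul_le_sum _ _ _ fun v hv => ?_
  have h := htop v
  rw [(Finset.mem_filter.mp hv).2] at h
  linarith [dist_triangle_left x z (loc v)]

/-- Lemma 3 of Gross–Anshelevich–Xia, restated: if a randomized
rule elects each candidate `x` with probability `p x`, electing only candidates
with `ν x > 0`, and `p x · (1 - ν x)/ν x ≤ B` whenever `ν x > 0`, then its
expected cost is at most `(1 + 2B)` times the cost of any candidate. -/
theorem first_choice_randomized_distortion {X : Type*} [PseudoMetricSpace X]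
    {V : Type*} [Fintype V] [Nonempty V] (loc : V → X)
    (C : Finset X)
    (top : V → X) (htopmem : ∀ v, top v ∈ C)
    (htop : ∀ (v : V), ∀ x ∈ C, dist (loc v) (top v) ≤ dist (loc v) x)
    (ν : X → ℝ)
    (hν : ∀ x, ν x = (Nat.card {v : V // top v = x} : ℝ) / (Fintype.card V : ℝ))
    (p : X → ℝ)
    (hp0 : ∀ x ∈ C, 0 ≤ p x)
    (hp1 : ∑ x ∈ C, p x = 1)
    (hpν : ∀ x ∈ C, ν x = 0 → p x = 0)
    (B : ℝ)
    (hB : ∀ x ∈ C, 0 < ν x → p x * (1 - ν x) / ν x ≤ B) :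
    ∀ z ∈ C, ∑ x ∈ C, p x * (∑ v, dist (loc v) x) ≤
      (1 + 2 * B) * ∑ v, dist (loc v) z := by
  classical
  intro z hz
  have hn : (0 : ℝ) < Fintype.card V := by exact_mod_cast Fintype.card_pos
  have hν' : ∀ x, ν x = ((Finset.univ.filter fun v => top v = x).card : ℝ) / Fintype.card V := by
    intro x
    rw [hν, Nat.card_eq_fintype_card, Fintype.card_subtype]
  have hcard_le : ∀ x,
      ((Finset.univ.filter fun v => top v = x).card : ℝ) ≤ Fintype.card V := by
    intro x
    exact_mod_cast Finset.card_le_univ _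
  have hB0 : 0 ≤ B := by
    obtain ⟨v⟩ := ‹Nonempty V›
    have hpos : 0 < ν (top v) := by
      rw [hν']
      refine div_pos ?_ hn
      exact_mod_cast Finset.card_pos.mpr ⟨v, by simp⟩
    have hle : ν (top v) ≤ 1 := by
      rw [hν', div_le_one hn]
      exact hcard_le _
    exact (div_nonneg (mul_nonneg (hp0 _ (htopmem v)) (sub_nonneg.mpr hle)) hpos.le).trans
      (hB _ (htopmem v) hpos)
  have hpB : ∀ x ∈ C,
      p x * ((Fintype.card V : ℝ) - (Finset.univ.filter fun v => top v = x).card) ≤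
        B * (Finset.univ.filter fun v => top v = x).card := by
    intro x hx
    have hcard : ((Finset.univ.filter fun v => top v = x).card : ℝ) = ν x * Fintype.card V := by
      rw [hν', div_mul_cancel₀ _ hn.ne']
    have hν0 : 0 ≤ ν x := by
      rw [hν']
      positivity
    rw [hcard]
    rcases hν0.eq_or_lt with h | h
    · simp [hpν x hx h.symm, ← h]
    · have h1 := (div_le_iff₀ h).mp (hB x hx h)
      nlinarith [mul_le_mul_of_nonneg_right h1 hn.le]
  have hterm : ∀ x ∈ C, p x * ∑ v, dist (loc v) x ≤
      p x * ∑ v, dist (loc v) z + 2 * B * ∑ v with top v = x, dist (loc v) z := by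
    intro x hx
    have h1 := mul_le_mul_of_nonneg_left
      (sum_dist_le_sum_dist_add_card_mul loc top x z fun v => htop v z hz) (hp0 x hx)
    have h2 := mul_le_mul_of_nonneg_right (hpB x hx) (dist_nonneg (x := x) (y := z))
    have h3 := mul_le_mul_of_nonneg_left
      (card_mul_dist_le_two_mul_sum loc top x z fun v => htop v z hz) hB0
    linarith
  refine (Finset.sum_le_sum hterm).trans_eq ?_
  rw [Finset.sum_add_distrib, ← Finset.sum_mul, hp1, ← Finset.mul_sum,
    Finset.sum_fiberwise_of_maps_to fun v _ => htopmem v]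
  ring
end

section
/- For every integer n ≥ 2 and every real t ∈ [0,1], (1 − 1/(n−1))·(1−t) + t·(1−t)/((n−1)·t² + (1−t)²) ≤ 1 − 1/n. -/
/-- technical bound: for every integer `n ≥ 2` and `t ∈ [0,1]`,
`(1 - 1/(n-1))(1-t) + t(1-t)/((n-1)t² + (1-t)²) ≤ 1 - 1/n`. -/
theorem technical_bound (n : ℕ) (hn : 2 ≤ n) (t : ℝ) (ht0 : 0 ≤ t) (ht1 : t ≤ 1) :
    (1 - 1 / ((n : ℝ) - 1)) * (1 - t)
      + t * (1 - t) / (((n : ℝ) - 1) * t ^ 2 + (1 - t) ^ 2) ≤ 1 - 1 / (n : ℝ) := by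
  have hn' : (2 : ℝ) ≤ n := by exact_mod_cast hn
  generalize (n : ℝ) = x at hn'
  have hx : 0 < x := by linarith
  have hx1 : 0 < x - 1 := by linarith
  have hD : 0 < (x - 1) * t ^ 2 + (1 - t) ^ 2 := by
    nlinarith [mul_nonneg (sub_nonneg.2 hn') (sq_nonneg t), sq_nonneg (2 * t - 1)]
  have gap : 1 - 1 / x - ((1 - 1 / (x - 1)) * (1 - t)
      + t * (1 - t) / ((x - 1) * t ^ 2 + (1 - t) ^ 2))
      = (x * t - 1) ^ 2 * ((x - 2) * t + 1)
        / ((x - 1) * x * ((x - 1) * t ^ 2 + (1 - t) ^ 2)) := by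
    have h0 := hx.ne'
    have h1 := hx1.ne'
    have h2 := hD.ne'
    field_simp
    ring
  have hfac : 0 ≤ (x - 2) * t + 1 := by
    linarith [mul_nonneg (sub_nonneg.2 hn') ht0]
  rw [← sub_nonneg, gap]
  positivity
end

section
/- Let n ≥ 2 be an integer, let ν_1, …, ν_n be nonnegative reals with Σ_{y=1}^n ν_y = 1, and let x be an index with ν_x > 0. Then [((n−2)/(n−1))·ν_x + (1/(n−1))·ν_x² / (Σ_{y=1}^n ν_y²)] · (1−ν_x)/ν_x ≤ 1 − 1/n. -/
/-- Cauchy–Schwarz away from one coordinate: the sum of squares of a vector with total mass one is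
smallest when the remaining mass is spread evenly over the other coordinates. -/
theorem card_sub_one_mul_sq_add_sq_le (n : ℕ) (ν : Fin n → ℝ) (hνsum : ∑ y, ν y = 1) (x : Fin n) :
    ((n : ℝ) - 1) * ν x ^ 2 + (1 - ν x) ^ 2 ≤ ((n : ℝ) - 1) * ∑ y, ν y ^ 2 := by
  have hsum := Finset.add_sum_erase Finset.univ ν (Finset.mem_univ x)
  have hsq := Finset.add_sum_erase Finset.univ (fun y => ν y ^ 2) (Finset.mem_univ x)
  have hcs := sq_sum_le_card_mul_sum_sq (s := Finset.univ.erase x) (f := ν)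
  have hcard : ((Finset.univ.erase x).card : ℝ) = (n : ℝ) - 1 := by
    rw [Finset.cast_card_erase_of_mem (Finset.mem_univ x), Finset.card_univ, Fintype.card_fin]
  have hrest : ∑ y ∈ Finset.univ.erase x, ν y = 1 - ν x := by linarith
  rw [hrest, hcard] at hcs
  rw [← hsq]
  linarith

/-- The two-variable inequality behind the bound; the slack is `(m * p - q) ^ 2 * (m * p + q)`
with `q = 1 - p`. -/
theorem mixture_two_value_bound {m p : ℝ} (hm : 0 < m) (hp : 0 < p) (hp1 : p ≤ 1) :
    ((m - 1) / m + p / (m * p ^ 2 + (1 - p) ^ 2)) * (1 - p) ≤ m / (m + 1) := by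
  have hD : 0 < m * p ^ 2 + (1 - p) ^ 2 := by positivity
  have hslack : 0 ≤ (m * p - (1 - p)) ^ 2 * (m * p + (1 - p)) :=
    mul_nonneg (sq_nonneg _) (add_nonneg (by positivity) (by linarith))
  rw [div_add_div _ _ hm.ne' hD.ne', div_mul_eq_mul_div, div_le_div_iff₀ (by positivity)
    (by positivity)]
  linarith

/-- bound on the election probability of candidate `x` (times
`(1-ν_x)/ν_x`) under the mixture of Random Dictatorship and Proportional to
Squares, given first-place vote fractions `ν` summing to 1. -/
theorem mixture_probability_bound (n : ℕ) (hn : 2 ≤ n)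
    (ν : Fin n → ℝ) (hν0 : ∀ y, 0 ≤ ν y) (hνsum : ∑ y, ν y = 1)
    (x : Fin n) (hx : 0 < ν x) :
    (((n : ℝ) - 2) / ((n : ℝ) - 1) * ν x
        + (1 / ((n : ℝ) - 1)) * (ν x) ^ 2 / (∑ y, (ν y) ^ 2))
      * (1 - ν x) / ν x ≤ 1 - 1 / (n : ℝ) := by
  have hn' : (2 : ℝ) ≤ n := by exact_mod_cast hn
  have hm : 0 < (n : ℝ) - 1 := by linarith
  have hp1 : ν x ≤ 1 :=
    hνsum ▸ Finset.single_le_sum (fun y _ => hν0 y) (Finset.mem_univ x)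
  have hS : 0 < ∑ y, ν y ^ 2 :=
    (pow_pos hx 2).trans_le
      (Finset.single_le_sum (f := fun y => ν y ^ 2) (fun y _ => sq_nonneg (ν y))
        (Finset.mem_univ x))
  have hD : 0 < ((n : ℝ) - 1) * ν x ^ 2 + (1 - ν x) ^ 2 := by positivity
  have hle := card_sub_one_mul_sq_add_sq_le n ν hνsum x
  calc _ = (((n : ℝ) - 1 - 1) / ((n : ℝ) - 1) + ν x / (((n : ℝ) - 1) * ∑ y, ν y ^ 2))
        * (1 - ν x) := by
        field_simp
        ring
    _ ≤ (((n : ℝ) - 1 - 1) / ((n : ℝ) - 1)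
          + ν x / (((n : ℝ) - 1) * ν x ^ 2 + (1 - ν x) ^ 2)) * (1 - ν x) := by
        have h1 : 0 ≤ 1 - ν x := by linarith
        gcongr
    _ ≤ ((n : ℝ) - 1) / ((n : ℝ) - 1 + 1) := mixture_two_value_bound hm hx hp1
    _ = 1 - 1 / (n : ℝ) := by
        rw [sub_add_cancel, sub_div, div_self (by linarith)]
end
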